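/- arXiv:2204.04723 — 3 statements merged into one kernel-verified Lean document; each statement's English description precedes it below -/
import Mathlib

section
/- Let b = (b₁, …, b_N) be an optimal allocation of B bits. Then there exists an index m ∈ {1, …, N} such that the allocation b′ defined by b′_m = b_m + 1 and b′_n = b_n for n ≠ m is an optimal allocation of B + 1 bits. (Proposition 1 of the paper, with the distortion–rate quantization distortion d_n(b) = σ_n²·2^{−b}.) -/
open Finset

/-- Changing one coordinate of `b` exchanges a single term of `∑ i, f i (b i)`. -/
theorem sum_update_add_eq {ι α M : Type*} [Fintype ι] [DecidableEq ι] [AddCommMonoid M]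
    (f : ι → α → M) (b : ι → α) (m : ι) (v : α) :
    ∑ i, f i (Function.update b m v i) + f m (b m) = ∑ i, f i (b i) + f m v := by
  rw [← add_sum_erase univ (fun i => f i (Function.update b m v i)) (mem_univ m),
    ← add_sum_erase univ (fun i => f i (b i)) (mem_univ m)]
  have h : ∑ i ∈ univ.erase m, f i (Function.update b m v i) = ∑ i ∈ univ.erase m, f i (b i) :=
    sum_congr rfl fun i hi => by rw [Function.update_of_ne (ne_of_mem_erase hi)]
  simp only [h, Function.update_self]
  abel

theorem sum_update_add_one {ι : Type*} [Fintype ι] [DecidableEq ι] (b : ι → ℕ) (m : ι) :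
    ∑ i, Function.update b m (b m + 1) i = ∑ i, b i + 1 := by
  have := sum_update_add_eq (fun _ k => k) b m (b m + 1)
  omega

theorem two_zpow_neg_succ (k : ℕ) :
    (2 : ℝ) ^ (-((k + 1 : ℕ) : ℤ)) = (2 : ℝ) ^ (-(k : ℤ)) / 2 := by
  rw [zpow_neg, zpow_neg, zpow_natCast, zpow_natCast, pow_succ, mul_inv, div_eq_mul_inv]

theorem one_sub_half_mul_le_two_zpow_neg (i : ℕ) :
    1 - (i : ℝ) / 2 ≤ (2 : ℝ) ^ (-(i : ℤ)) := by
  have h := one_add_mul_le_pow (a := (-1 / 2 : ℝ)) (by norm_num) i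
  rw [zpow_neg, zpow_natCast, ← inv_pow]
  norm_num at h ⊢
  linarith

/-- If the slope `-t` is a subgradient of `k ↦ s * 2 ^ (-k)` at `k`, as witnessed by the two
neighbouring increments, then `k` minimizes the Lagrangian `j ↦ s * 2 ^ (-j) + t * j`. -/
theorem lagrangian_le {s t : ℝ} (hs : 0 ≤ s) {k : ℕ}
    (hnext : s * (2 : ℝ) ^ (-(k : ℤ)) / 2 ≤ t)
    (hprev : 1 ≤ k → t ≤ s * (2 : ℝ) ^ (-(k : ℤ))) (j : ℕ) :
    s * (2 : ℝ) ^ (-(k : ℤ)) + t * k ≤ s * (2 : ℝ) ^ (-(j : ℤ)) + t * j := by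
  have hx : 0 ≤ s * (2 : ℝ) ^ (-(k : ℤ)) := by positivity
  rcases le_or_gt k j with h | h
  · obtain ⟨i, rfl⟩ := Nat.exists_eq_add_of_le h
    have hpow : s * (2 : ℝ) ^ (-((k + i : ℕ) : ℤ)) =
        s * (2 : ℝ) ^ (-(k : ℤ)) * (2 : ℝ) ^ (-(i : ℤ)) := by
      rw [mul_assoc, ← zpow_add₀ two_ne_zero]
      push_cast
      ring_nf
    have h₁ := mul_le_mul_of_nonneg_left (one_sub_half_mul_le_two_zpow_neg i) hx
    have h₂ := mul_le_mul_of_nonneg_right hnext (Nat.cast_nonneg (α := ℝ) i)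
    rw [hpow]
    push_cast
    linarith
  · obtain ⟨i, rfl⟩ := Nat.exists_eq_add_of_le h.le
    have hpow : s * (2 : ℝ) ^ (-(j : ℤ)) =
        s * (2 : ℝ) ^ (-((j + i : ℕ) : ℤ)) * (2 : ℝ) ^ i := by
      rw [← zpow_natCast, mul_assoc, ← zpow_add₀ two_ne_zero]
      push_cast
      ring_nf
    have hB : 1 + (i : ℝ) ≤ 2 ^ i := by
      have := one_add_mul_le_pow (a := (1 : ℝ)) (by norm_num) i
      norm_num at this
      exact this
    have h₁ := mul_le_mul_of_nonneg_left hB hx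
    have h₂ := mul_le_mul_of_nonneg_right (hprev (by omega)) (Nat.cast_nonneg (α := ℝ) i)
    rw [hpow]
    push_cast at h₁ h₂ ⊢
    linarith

/-- Proposition 1: if `b` is an optimal allocation of `B` bits (with distortion
`D(b) = ∑ σ n · 2^{-b n}`), then there is an index `m` such that adding one bit to
component `m` yields an optimal allocation of `B + 1` bits. -/
theorem optimal_allocation_succ
    {N : ℕ} (hN : 1 ≤ N) (σ : Fin N → ℝ) (hσ : ∀ n, 0 ≤ σ n)
    (B : ℕ) (b : Fin N → ℕ) (hb : ∑ n, b n = B)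
    (hopt : ∀ b' : Fin N → ℕ, ∑ n, b' n = B →
      ∑ n, σ n * (2 : ℝ) ^ (-(b n : ℤ)) ≤ ∑ n, σ n * (2 : ℝ) ^ (-(b' n : ℤ))) :
    ∃ m : Fin N,
      (∑ n, Function.update b m (b m + 1) n = B + 1) ∧
      (∀ b' : Fin N → ℕ, ∑ n, b' n = B + 1 →
        ∑ n, σ n * (2 : ℝ) ^ (-((Function.update b m (b m + 1) n : ℕ) : ℤ)) ≤
          ∑ n, σ n * (2 : ℝ) ^ (-(b' n : ℤ))) := by
  have : Nonempty (Fin N) := ⟨⟨0, hN⟩⟩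
  obtain ⟨m, -, hm⟩ := exists_max_image univ (fun n => σ n * (2 : ℝ) ^ (-(b n : ℤ))) univ_nonempty
  have hsum : ∑ n, Function.update b m (b m + 1) n = B + 1 := by rw [sum_update_add_one, hb]
  refine ⟨m, hsum, fun c hc => ?_⟩
  -- Moving a bit from `n` to `m` does not decrease the distortion of `b`.
  have hmove : ∀ n, n ≠ m → 1 ≤ b n →
      σ m * (2 : ℝ) ^ (-(b m : ℤ)) / 2 ≤ σ n * (2 : ℝ) ^ (-(b n : ℤ)) := by
    intro n hn hbn
    obtain ⟨k, hk⟩ := Nat.exists_eq_add_of_le' hbn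
    set e := Function.update b n k
    have hem : e m = b m := Function.update_of_ne hn.symm _ _
    have hcard : ∑ i, Function.update e m (e m + 1) i = B := by
      have : ∑ i, e i + b n = ∑ i, b i + k := sum_update_add_eq (fun _ k => k) b n k
      rw [sum_update_add_one]
      omega
    have h₁ := sum_update_add_eq (fun i (k : ℕ) => σ i * (2 : ℝ) ^ (-(k : ℤ))) b n k
    have h₂ := sum_update_add_eq (fun i (k : ℕ) => σ i * (2 : ℝ) ^ (-(k : ℤ))) e m (e m + 1)
    have h₃ := hopt _ hcard
    simp only [hem, hk, two_zpow_neg_succ] at h₁ h₂ h₃ ⊢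
    linarith
  have hlag : ∀ n,
      σ n * (2 : ℝ) ^ (-((Function.update b m (b m + 1) n : ℕ) : ℤ)) +
          σ m * (2 : ℝ) ^ (-(b m : ℤ)) / 2 * (Function.update b m (b m + 1) n : ℕ) ≤
        σ n * (2 : ℝ) ^ (-(c n : ℤ)) + σ m * (2 : ℝ) ^ (-(b m : ℤ)) / 2 * c n := by
    intro n
    apply lagrangian_le (hσ n)
    · rcases eq_or_ne n m with rfl | hn
      · have : 0 ≤ σ n * (2 : ℝ) ^ (-(b n : ℤ)) := mul_nonneg (hσ n) (by positivity)
        rw [Function.update_self, two_zpow_neg_succ]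
        linarith
      · rw [Function.update_of_ne hn]
        linarith [hm n (mem_univ n)]
    · intro h
      rcases eq_or_ne n m with rfl | hn
      · rw [Function.update_self, two_zpow_neg_succ, mul_div_assoc]
      · rw [Function.update_of_ne hn] at h ⊢
        exact hmove n hn h
  have htotal := sum_le_sum fun n (_ : n ∈ univ) => hlag n
  rw [sum_add_distrib, sum_add_distrib, ← mul_sum, ← mul_sum, ← Nat.cast_sum, ← Nat.cast_sum,
    hsum, hc] at htotal
  linarith
end

section
/- Assume the variances are strictly decreasing: σ_n² > σ_{n+1}² ≥ 0 for all n ∈ {1, …, N−1}. If b = (b₁, …, b_N) is an optimal allocation of B bits, then b is nonincreasing: b_n ≤ b_{n−1} for every n ∈ {2, …, N}. (Proposition 2 of the paper.) -/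
open Finset

/-- Exchanging two values of `w` changes the weighted sum `∑ n, σ n * w n` by
`(σ i - σ j) * (w i - w j)`. -/
theorem sum_mul_sub_sum_mul_comp_swap {ι R : Type*} [Fintype ι] [DecidableEq ι] [CommRing R]
    (σ w : ι → R) {i j : ι} (hij : i ≠ j) :
    ∑ n, σ n * w n - ∑ n, σ n * w (Equiv.swap i j n) = (σ i - σ j) * (w i - w j) := by
  rw [← Finset.sum_sub_distrib, Fintype.sum_eq_add i j hij]
  · rw [Equiv.swap_apply_left, Equiv.swap_apply_right]
    ring
  · rintro n ⟨hni, hnj⟩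
    rw [Equiv.swap_apply_of_ne_of_ne hni hnj, sub_self]

/-- Proposition 2: with strictly decreasing nonnegative variances, any optimal
allocation of `B` bits is nonincreasing in the component index. -/
theorem optimal_allocation_antitone
    {N : ℕ} (hN : 1 ≤ N) (σ : Fin N → ℝ) (hσ : ∀ n, 0 ≤ σ n)
    (hdec : StrictAnti σ)
    (B : ℕ) (b : Fin N → ℕ) (hb : ∑ n, b n = B)
    (hopt : ∀ b' : Fin N → ℕ, ∑ n, b' n = B →
      ∑ n, σ n * (2 : ℝ) ^ (-(b n : ℤ)) ≤ ∑ n, σ n * (2 : ℝ) ^ (-(b' n : ℤ))) :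
    Antitone b := by
  intro i j hij
  by_contra! hlt
  have hne : i ≠ j := by
    rintro rfl
    exact lt_irrefl _ hlt
  have hσij : σ j < σ i := hdec (lt_of_le_of_ne hij hne)
  have hpow : (2 : ℝ) ^ (-(b j : ℤ)) < (2 : ℝ) ^ (-(b i : ℤ)) :=
    zpow_lt_zpow_right₀ one_lt_two (by omega)
  have hle := hopt (fun n => b (Equiv.swap i j n)) ((Equiv.sum_comp (Equiv.swap i j) b).trans hb)
  have hdiff := sum_mul_sub_sum_mul_comp_swap σ (fun n => (2 : ℝ) ^ (-(b n : ℤ))) hne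
  have hpos := mul_pos (sub_pos.2 hσij) (sub_pos.2 hpow)
  linarith
end

section
/- Let b be an optimal allocation of B bits, and let m* ∈ {1, …, N} be an index minimizing D(b + e_m) over all m ∈ {1, …, N} (equivalently, maximizing the distortion decrease σ_m²·2^{−b_m} − σ_m²·2^{−(b_m+1)}). Then b + e_{m*} is an optimal allocation of B + 1 bits. (Correctness of the greedy bit-allocation step in Algorithm 1, as a corollary of Proposition 1.) -/
open Finset

/-- Granting one more bit to component `m` lowers the distortion by half of the distortion of
component `m`. -/
theorem sum_distortion_update_succ {ι : Type*} [Fintype ι] [DecidableEq ι] (σ : ι → ℝ)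
    (b : ι → ℕ) (m : ι) :
    ∑ n, σ n * (2 : ℝ) ^ (-((Function.update b m (b m + 1) n : ℕ) : ℤ)) =
      ∑ n, σ n * (2 : ℝ) ^ (-(b n : ℤ)) - σ m * (2 : ℝ) ^ (-(b m : ℤ)) / 2 := by
  have key : ∀ n, σ n * (2 : ℝ) ^ (-((Function.update b m (b m + 1) n : ℕ) : ℤ)) =
      σ n * (2 : ℝ) ^ (-(b n : ℤ)) -
        if n = m then σ m * (2 : ℝ) ^ (-(b m : ℤ)) / 2 else 0 := by
    intro n
    rcases eq_or_ne n m with rfl | h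
    · rw [Function.update_self, if_pos rfl, Nat.cast_succ, neg_add, zpow_add₀ two_ne_zero,
        zpow_neg_one]
      ring
    · rw [Function.update_of_ne h, if_neg h, sub_zero]
  simp only [key, sum_sub_distrib, sum_ite_eq', mem_univ, if_true]

/-- Granting one more bit to a component raises the total number of bits by one. -/
theorem sum_update_succ {ι : Type*} [Fintype ι] [DecidableEq ι] (b : ι → ℕ) (m : ι) :
    ∑ n, Function.update b m (b m + 1) n = ∑ n, b n + 1 := by
  rw [sum_update_of_mem (mem_univ m), sdiff_singleton_eq_erase, ← add_sum_erase univ b (mem_univ m)]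
  ring

/-- Correctness of the greedy step of Algorithm 1: if `b` is an optimal allocation of
`B` bits and `m*` minimizes the distortion of `b + e_m` over all components `m`
(equivalently, maximizes the distortion decrease), then `b + e_{m*}` is an optimal
allocation of `B + 1` bits. -/
theorem greedy_step_optimal
    {N : ℕ} (hN : 1 ≤ N) (σ : Fin N → ℝ) (hσ : ∀ n, 0 ≤ σ n)
    (B : ℕ) (b : Fin N → ℕ) (hb : ∑ n, b n = B)
    (hopt : ∀ b' : Fin N → ℕ, ∑ n, b' n = B →
      ∑ n, σ n * (2 : ℝ) ^ (-(b n : ℤ)) ≤ ∑ n, σ n * (2 : ℝ) ^ (-(b' n : ℤ)))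
    (mstar : Fin N)
    (hmstar : ∀ m : Fin N,
      ∑ n, σ n * (2 : ℝ) ^ (-((Function.update b mstar (b mstar + 1) n : ℕ) : ℤ)) ≤
        ∑ n, σ n * (2 : ℝ) ^ (-((Function.update b m (b m + 1) n : ℕ) : ℤ))) :
    (∑ n, Function.update b mstar (b mstar + 1) n = B + 1) ∧
    (∀ b' : Fin N → ℕ, ∑ n, b' n = B + 1 →
      ∑ n, σ n * (2 : ℝ) ^ (-((Function.update b mstar (b mstar + 1) n : ℕ) : ℤ)) ≤
        ∑ n, σ n * (2 : ℝ) ^ (-(b' n : ℤ))) := by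
  refine ⟨by rw [sum_update_succ, hb], fun b' hb' => ?_⟩
  obtain ⟨j, -, hj⟩ : ∃ j ∈ univ, b j < b' j := exists_lt_of_sum_lt (by omega)
  obtain ⟨c, rfl⟩ : ∃ c : Fin N → ℕ, b' = Function.update c j (c j + 1) := by
    refine ⟨Function.update b' j (b' j - 1), ?_⟩
    rw [Function.update_self, Function.update_idem, Nat.sub_add_cancel (by omega),
      Function.update_eq_self]
  rw [sum_update_succ] at hb'
  rw [Function.update_self] at hj
  have hc := hopt c (by omega)
  have hgain : σ j * (2 : ℝ) ^ (-(c j : ℤ)) ≤ σ j * (2 : ℝ) ^ (-(b j : ℤ)) :=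
    mul_le_mul_of_nonneg_left (zpow_le_zpow_right₀ one_le_two (by omega)) (hσ j)
  have hstep := hmstar j
  rw [sum_distortion_update_succ σ b j] at hstep
  rw [sum_distortion_update_succ σ c j]
  linarith
end
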